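/- arXiv:2303.14808 — 2 statements merged into one kernel-verified Lean document; each statement's English description precedes it below -/
import Mathlib

section
/- Let μ be a symmetric Borel probability measure on ℝ all of whose moments are finite (∫_ℝ |λ|^n dμ(λ) < ∞ for every n ∈ ℕ), and let F be a continuous centered stationary Gaussian process with spectral measure μ. Then there exist c > 0 and M₀ > 0 such that for every M ≥ M₀, P( for all s ∈ ℝ, |F_s| ≤ M·(1 + |s|) ) ≥ 1 − exp(−c·M²). -/
open MeasureTheory ProbabilityTheory Set ENNReal NNReal

/-- The covariance kernel of a spectral measure: `k(t) = ∫ cos (λ t) dμ(λ)`. -/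
noncomputable def covKernel (μ : Measure ℝ) (t : ℝ) : ℝ := ∫ l, Real.cos (l * t) ∂μ

/-- `F` is a continuous centered stationary Gaussian process on `(Ω, P)` with spectral
measure `μ`: sample paths are continuous and every finite linear combination
`∑ cᵢ F_{tᵢ}` is a centered real Gaussian with variance `∑ᵢⱼ cᵢ cⱼ k(tᵢ - tⱼ)`. -/
def IsSGP {Ω : Type*} [MeasurableSpace Ω] (P : Measure Ω) (μ : Measure ℝ)
    (F : ℝ → Ω → ℝ) : Prop :=
  (∀ ω, Continuous fun t => F t ω) ∧
  ∀ (n : ℕ) (t : Fin n → ℝ) (c : Fin n → ℝ),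
    P.map (fun ω => ∑ i, c i * F (t i) ω) =
      gaussianReal 0 (∑ i, ∑ j, c i * c j * covKernel μ (t i - t j)).toNNReal

/-- The zero count `N_F(T)` as an extended natural number. -/
noncomputable def zeroCount {Ω : Type*} (F : ℝ → Ω → ℝ) (T : ℝ) (ω : Ω) : ℕ∞ :=
  {t ∈ Set.Icc (0:ℝ) T | F t ω = 0}.encard

/-- The topological support of a Borel measure on ℝ. -/
def msupport (μ : Measure ℝ) : Set ℝ := {x : ℝ | ∀ U ∈ nhds x, 0 < μ U}

/-- A real random variable with law `gaussianReal 0 v` is sub-Gaussian with any parameter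
at least `v`. -/
lemma hasSubgaussianMGF_of_map_eq_gaussianReal {Ω : Type*} [MeasurableSpace Ω] {P : Measure Ω}
    {X : Ω → ℝ} {v s : ℝ≥0} (hX : P.map X = gaussianReal 0 v) (hvs : v ≤ s) :
    HasSubgaussianMGF X s P where
  integrable_exp_mul t := by
    have hXm : AEMeasurable X P := aemeasurable_of_map_neZero (by rw [hX]; infer_instance)
    have h := integrable_exp_mul_gaussianReal (μ := 0) (v := v) t
    rw [← hX] at h
    exact h.comp_aemeasurable hXm
  mgf_le t := by
    rw [mgf_gaussianReal hX, zero_mul, zero_add]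
    gcongr

/-- Two-sided Chernoff bound for a sub-Gaussian random variable. -/
lemma HasSubgaussianMGF.measure_lt_abs_le {Ω : Type*} [MeasurableSpace Ω] {P : Measure Ω}
    [IsFiniteMeasure P] {X : Ω → ℝ} {s : ℝ≥0} (h : HasSubgaussianMGF X s P) {u : ℝ}
    (hu : 0 ≤ u) :
    P {ω | u < |X ω|} ≤ ENNReal.ofReal (2 * Real.exp (-u ^ 2 / (2 * s))) := by
  have hsub : {ω | u < |X ω|} ⊆ {ω | u ≤ X ω} ∪ {ω | u ≤ (-X) ω} := by
    intro ω hω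
    rcases lt_abs.1 (show u < |X ω| from hω) with h1 | h1
    · exact Or.inl h1.le
    · exact Or.inr h1.le
  rw [← ofReal_measureReal]
  refine ENNReal.ofReal_le_ofReal ?_
  calc P.real {ω | u < |X ω|}
      ≤ P.real ({ω | u ≤ X ω} ∪ {ω | u ≤ (-X) ω}) := measureReal_mono hsub
    _ ≤ P.real {ω | u ≤ X ω} + P.real {ω | u ≤ (-X) ω} := measureReal_union_le _ _
    _ ≤ 2 * Real.exp (-u ^ 2 / (2 * s)) := by
        linarith [h.measure_ge_le hu, h.neg.measure_ge_le hu]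

/-- A countable family of sub-Gaussian variables `X i` with parameters `s i` is dominated by
`M * w i`, outside an event of Gaussian-small probability in `M`, as soon as the ratios
`y i = w i ^ 2 / (2 * s i)` are bounded below and `∑ 1 / y i ^ 2` converges. -/
lemma exists_measure_exists_lt_abs_le {Ω ι : Type*} [MeasurableSpace Ω] [Countable ι]
    {P : Measure Ω} [IsFiniteMeasure P] {X : ι → Ω → ℝ} {s : ι → ℝ≥0} {w y : ι → ℝ}
    {δ : ℝ} (hX : ∀ i, HasSubgaussianMGF (X i) (s i) P) (hw : ∀ i, 0 ≤ w i)
    (hy : ∀ i, w i ^ 2 / (2 * s i) = y i) (hδ : 0 < δ) (hδy : ∀ i, δ ≤ y i)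
    (hsum : Summable fun i => 1 / y i ^ 2) :
    ∃ c > (0 : ℝ), ∃ M₀ > (0 : ℝ), ∀ M ≥ M₀,
      P {ω | ∃ i, M * w i < |X i ω|} ≤ ENNReal.ofReal (Real.exp (-c * M ^ 2)) := by
  set K : ℝ := ∑' i, 16 * (1 / y i ^ 2)
  refine ⟨δ / 4, by positivity, max 1 (4 * K / δ), by positivity, fun M hM => ?_⟩
  have hM1 : 1 ≤ M := (le_max_left _ _).trans hM
  have hMK : 4 * K / δ ≤ M := (le_max_right _ _).trans hM
  have hMM : M ≤ M ^ 2 := by nlinarith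
  have hterm : ∀ i, P {ω | M * w i < |X i ω|} ≤
      ENNReal.ofReal (Real.exp (-(δ / 2) * M ^ 2) * (16 * (1 / y i ^ 2))) := by
    intro i
    have hyi : 0 < y i := hδ.trans_le (hδy i)
    refine (HasSubgaussianMGF.measure_lt_abs_le (hX i)
      (mul_nonneg (by linarith) (hw i))).trans (ENNReal.ofReal_le_ofReal ?_)
    have h1 : -(M * w i) ^ 2 / (2 * s i) = -(M ^ 2 * y i) := by
      rw [← hy i]; ring
    have h2 : -(M ^ 2 * y i) ≤ -(δ / 2) * M ^ 2 + -(y i / 2) := by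
      nlinarith [mul_le_mul_of_nonneg_left (hδy i) (sq_nonneg M),
        mul_le_mul_of_nonneg_right (hM1.trans hMM) hyi.le]
    have h3 : Real.exp (-(y i / 2)) ≤ 8 * (1 / y i ^ 2) := by
      rw [Real.exp_neg, mul_one_div, inv_le_comm₀ (Real.exp_pos _) (by positivity), inv_div]
      nlinarith [Real.quadratic_le_exp_of_nonneg (half_pos hyi).le]
    rw [h1]
    calc 2 * Real.exp (-(M ^ 2 * y i))
        ≤ 2 * (Real.exp (-(δ / 2) * M ^ 2) * Real.exp (-(y i / 2))) := by
          rw [← Real.exp_add]; gcongr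
      _ ≤ 2 * (Real.exp (-(δ / 2) * M ^ 2) * (8 * (1 / y i ^ 2))) := by gcongr
      _ = _ := by ring
  have hK : K ≤ Real.exp (δ / 4 * M ^ 2) := by
    rw [div_le_iff₀ hδ] at hMK
    have := Real.add_one_le_exp (δ / 4 * M ^ 2)
    nlinarith
  calc P {ω | ∃ i, M * w i < |X i ω|}
      ≤ ∑' i, P {ω | M * w i < |X i ω|} := by
        rw [Set.ofPred_exists]; exact measure_iUnion_le _
    _ ≤ ∑' i, ENNReal.ofReal (Real.exp (-(δ / 2) * M ^ 2) * (16 * (1 / y i ^ 2))) :=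
        ENNReal.tsum_le_tsum hterm
    _ = ENNReal.ofReal (Real.exp (-(δ / 2) * M ^ 2) * K) := by
        rw [← ENNReal.ofReal_tsum_of_nonneg (fun i => by positivity)
          ((hsum.mul_left 16).mul_left _), (hsum.mul_left 16).tsum_mul_left]
    _ ≤ ENNReal.ofReal (Real.exp (-(δ / 4) * M ^ 2)) := by
        refine ENNReal.ofReal_le_ofReal ?_
        calc Real.exp (-(δ / 2) * M ^ 2) * K
            ≤ Real.exp (-(δ / 2) * M ^ 2) * Real.exp (δ / 4 * M ^ 2) := by gcongr
          _ = Real.exp (-(δ / 4) * M ^ 2) := by rw [← Real.exp_add]; ring_nf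

/-- The value `f k` at level `j = 0`, and the dyadic increment `f ((k + 1) / 2 ^ j) - f (k / 2 ^ j)`
at level `j > 0`, for `i = (j, k)`. -/
noncomputable def dyadicIncrement (f : ℝ → ℝ) (i : ℕ × ℤ) : ℝ :=
  if i.1 = 0 then f i.2 else f ((i.2 + 1) / 2 ^ i.1) - f (i.2 / 2 ^ i.1)

/-- The weight against which dyadic increments are compared. -/
noncomputable def dyadicWeight (i : ℕ × ℤ) : ℝ :=
  1 / 8 * (3 / 4) ^ i.1 * (1 + |(i.2 : ℝ)| / 2 ^ i.1)

lemma dyadicWeight_nonneg (i : ℕ × ℤ) : 0 ≤ dyadicWeight i := by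
  unfold dyadicWeight; positivity

lemma dyadicWeight_le {j : ℕ} {k : ℤ} {s : ℝ} (h : |(k : ℝ) / 2 ^ j - s| ≤ 1) :
    dyadicWeight (j, k) ≤ 1 / 8 * (3 / 4) ^ j * (2 + |s|) := by
  have h1 : |(k : ℝ)| / 2 ^ j ≤ 1 + |s| := by
    have hk : |(k : ℝ) / 2 ^ j| = |(k : ℝ)| / 2 ^ j := by
      rw [abs_div, abs_of_pos (show (0 : ℝ) < 2 ^ j by positivity)]
    linarith [abs_sub_abs_le_abs_sub ((k : ℝ) / 2 ^ j) s]
  exact mul_le_mul_of_nonneg_left (by linarith) (by positivity)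

/-- The left dyadic approximation of `s` at level `j` is within `2 ^ (-j)` of `s`. -/
lemma abs_floor_div_two_pow_sub_le (s : ℝ) (j : ℕ) :
    |(⌊2 ^ j * s⌋ : ℝ) / 2 ^ j - s| ≤ (1 / 2) ^ j := by
  have hp : (0 : ℝ) < 2 ^ j := by positivity
  have h : (⌊2 ^ j * s⌋ : ℝ) / 2 ^ j - s = (⌊2 ^ j * s⌋ - 2 ^ j * s) / 2 ^ j := by
    field_simp
  rw [h, abs_div, abs_of_pos hp, one_div_pow]
  gcongr
  rw [abs_le]
  constructor <;> linarith [Int.floor_le (2 ^ j * s), Int.lt_floor_add_one (2 ^ j * s)]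

/-- Consecutive dyadic approximations differ by at most one dyadic increment. -/
lemma abs_sub_dyadic_le (f : ℝ → ℝ) (s : ℝ) (j : ℕ) :
    |f (⌊2 ^ j * s⌋ / 2 ^ j) - f (⌊2 ^ (j + 1) * s⌋ / 2 ^ (j + 1))| ≤
      |dyadicIncrement f (j + 1, 2 * ⌊2 ^ j * s⌋)| := by
  set k := ⌊2 ^ j * s⌋ with hk
  have h1 : (k : ℝ) ≤ 2 ^ j * s := Int.floor_le _
  have h2 : 2 ^ j * s < k + 1 := Int.lt_floor_add_one _
  have hdiv : (k : ℝ) / 2 ^ j = (2 * k) / 2 ^ (j + 1) := by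
    rw [pow_succ]; field_simp
  rcases lt_or_ge (2 ^ (j + 1) * s) (2 * k + 1) with h | h
  · have hfl : ⌊2 ^ (j + 1) * s⌋ = 2 * k := by
      rw [Int.floor_eq_iff]; push_cast
      constructor
      · rw [pow_succ]; linarith
      · exact h
    rw [hfl, hdiv]
    push_cast
    simp
  · have hfl : ⌊2 ^ (j + 1) * s⌋ = 2 * k + 1 := by
      rw [Int.floor_eq_iff]; push_cast
      constructor
      · exact h
      · rw [pow_succ]; linarith
    rw [hfl, hdiv, abs_sub_comm]
    simp [dyadicIncrement]

/-- A continuous function with controlled dyadic increments grows at most linearly. -/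
lemma abs_le_of_dyadicIncrement_le {f : ℝ → ℝ} (hf : Continuous f) {M : ℝ} (hM : 0 ≤ M)
    (h : ∀ i, |dyadicIncrement f i| ≤ M * dyadicWeight i) (s : ℝ) :
    |f s| ≤ M * (1 + |s|) := by
  have happrox : Filter.Tendsto (fun j : ℕ => (⌊2 ^ j * s⌋ : ℝ) / 2 ^ j) Filter.atTop (nhds s) := by
    rw [tendsto_iff_dist_tendsto_zero]
    exact squeeze_zero (fun _ => dist_nonneg) (fun j => abs_floor_div_two_pow_sub_le s j)
      (tendsto_pow_atTop_nhds_zero_of_lt_one (by norm_num) (by norm_num))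
  have hlim := (hf.tendsto s).comp happrox
  have hgeom := (hasSum_geometric_of_lt_one (r := (3 / 4 : ℝ)) (by norm_num)
    (by norm_num)).mul_left (M * (3 / 32) * (2 + |s|))
  have hstep : ∀ j : ℕ, dist (f (⌊2 ^ j * s⌋ / 2 ^ j)) (f (⌊2 ^ (j + 1) * s⌋ / 2 ^ (j + 1))) ≤
      M * (3 / 32) * (2 + |s|) * (3 / 4) ^ j := by
    intro j
    have hdiv : ((2 * ⌊2 ^ j * s⌋ : ℤ) : ℝ) / 2 ^ (j + 1) = ⌊2 ^ j * s⌋ / 2 ^ j := by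
      rw [pow_succ]; push_cast; field_simp
    have hw := dyadicWeight_le (j := j + 1) (k := 2 * ⌊2 ^ j * s⌋) (s := s) (by
      rw [hdiv]
      exact (abs_floor_div_two_pow_sub_le s j).trans (pow_le_one₀ (by norm_num) (by norm_num)))
    calc _ ≤ |dyadicIncrement f (j + 1, 2 * ⌊2 ^ j * s⌋)| := abs_sub_dyadic_le f s j
      _ ≤ M * dyadicWeight (j + 1, 2 * ⌊2 ^ j * s⌋) := h _
      _ ≤ M * (1 / 8 * (3 / 4) ^ (j + 1) * (2 + |s|)) := by gcongr
      _ = _ := by rw [pow_succ]; ring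
  have hdist := dist_le_tsum_of_dist_le_of_tendsto₀ _ hstep hgeom.summable hlim
  rw [hgeom.tsum_eq, Real.dist_eq] at hdist
  have hzero : |f (⌊2 ^ 0 * s⌋ / 2 ^ 0)| ≤ M * (1 / 8 * (2 + |s|)) := by
    have h0 := h (0, ⌊s⌋)
    have hw := dyadicWeight_le (by simpa using abs_floor_div_two_pow_sub_le s 0 :
      |(⌊s⌋ : ℝ) / 2 ^ 0 - s| ≤ 1)
    have h1 := h0.trans (mul_le_mul_of_nonneg_left hw hM)
    simpa [dyadicIncrement] using h1
  have htri := abs_sub_abs_le_abs_sub (f s) (f (⌊2 ^ 0 * s⌋ / 2 ^ 0))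
  rw [abs_sub_comm] at htri
  have hMs : 0 ≤ M * |s| := by positivity
  norm_num at hdist hzero htri
  linarith

lemma covKernel_zero (μ : Measure ℝ) [IsProbabilityMeasure μ] : covKernel μ 0 = 1 := by
  simp [covKernel]

lemma covKernel_neg (μ : Measure ℝ) (t : ℝ) : covKernel μ (-t) = covKernel μ t := by
  simp [covKernel]

/-- A spectral measure with finite second moment has a covariance kernel that is quadratically
close to `1` near the origin. -/
lemma one_sub_covKernel_le (μ : Measure ℝ) [IsProbabilityMeasure μ]
    (hμ : Integrable (fun l : ℝ => l ^ 2) μ) (t : ℝ) :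
    1 - covKernel μ t ≤ (∫ l, l ^ 2 ∂μ) * t ^ 2 / 2 := by
  have hcos : Integrable (fun l : ℝ => Real.cos (l * t)) μ :=
    Integrable.of_bound (by fun_prop) 1 (.of_forall fun l => Real.abs_cos_le_one _)
  have h : ∫ l, (1 - l ^ 2 * (t ^ 2 / 2)) ∂μ ≤ covKernel μ t := by
    refine integral_mono ((integrable_const _).sub (hμ.mul_const _)) hcos fun l => ?_
    have := Real.one_sub_sq_div_two_le_cos (x := l * t)
    simp only
    linarith [mul_pow l t 2]
  rw [integral_sub (integrable_const _) (hμ.mul_const _), integral_mul_const] at h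
  simp only [integral_const, probReal_univ, smul_eq_mul, mul_one] at h
  linarith

section SGP

variable {Ω : Type*} [MeasurableSpace Ω] {P : Measure Ω} {μ : Measure ℝ} [IsProbabilityMeasure μ]
  {F : ℝ → Ω → ℝ}

lemma IsSGP.map_eval (hF : IsSGP P μ F) (t : ℝ) : P.map (F t) = gaussianReal 0 1 := by
  simpa [covKernel_zero] using hF.2 1 ![t] ![1]

lemma IsSGP.map_sub (hF : IsSGP P μ F) (t u : ℝ) :
    P.map (fun ω => F t ω - F u ω) = gaussianReal 0 (2 * (1 - covKernel μ (t - u))).toNNReal := by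
  have h := hF.2 2 ![t, u] ![1, -1]
  have hk : covKernel μ (u - t) = covKernel μ (t - u) := by
    rw [← covKernel_neg, neg_sub]
  simp only [Fin.sum_univ_two, Matrix.cons_val_zero, Matrix.cons_val_one, sub_self,
    covKernel_zero, hk] at h
  convert h using 3
  · ring
  · ring

/-- Dyadic increments of a stationary Gaussian process with finite second spectral moment are
sub-Gaussian, with parameter decaying like `4 ^ (-j)`. -/
lemma IsSGP.hasSubgaussianMGF_dyadicIncrement (hF : IsSGP P μ F)
    (hμ : Integrable (fun l : ℝ => l ^ 2) μ) (i : ℕ × ℤ) :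
    HasSubgaussianMGF (fun ω => dyadicIncrement (fun t => F t ω) i)
      ((1 + ∫ l, l ^ 2 ∂μ) / 4 ^ i.1).toNNReal P := by
  have hm : 0 ≤ ∫ l, l ^ 2 ∂μ := integral_nonneg fun l => sq_nonneg l
  obtain ⟨j, k⟩ := i
  rcases eq_or_ne j 0 with rfl | hj
  · refine hasSubgaussianMGF_of_map_eq_gaussianReal (v := 1) ?_ ?_
    · simpa [dyadicIncrement] using hF.map_eval k
    · simpa [Real.one_le_toNNReal] using hm
  · simp only [dyadicIncrement, hj, if_false]
    refine hasSubgaussianMGF_of_map_eq_gaussianReal (hF.map_sub _ _) (Real.toNNReal_le_toNNReal ?_)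
    have hd : ((k : ℝ) + 1) / 2 ^ j - k / 2 ^ j = (1 / 2) ^ j := by
      rw [one_div_pow]; ring
    have h4 : (((1 : ℝ) / 2) ^ j) ^ 2 = 1 / 4 ^ j := by
      rw [← pow_mul, mul_comm, pow_mul, ← one_div_pow]; norm_num
    have h := one_sub_covKernel_le μ hμ ((1 / 2) ^ j)
    rw [h4] at h
    have hp : (0 : ℝ) ≤ 1 / 4 ^ j := by positivity
    have hC : (1 + ∫ l, l ^ 2 ∂μ) / 4 ^ j = 1 / 4 ^ j + (∫ l, l ^ 2 ∂μ) * (1 / 4 ^ j) := by ring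
    rw [hd, hC]
    linarith

end SGP

/-- The squared weights dominate, relative to `4 ^ (-j)`, a uniformly positive family whose inverse
squares are summable. -/
lemma summable_dyadic {C : ℝ} (hC : 0 < C) :
    Summable fun i : ℕ × ℤ =>
      1 / ((9 / 4 : ℝ) ^ i.1 * (1 + |(i.2 : ℝ)| / 2 ^ i.1) ^ 2 / (128 * C)) ^ 2 := by
  have hint : Summable fun k : ℤ => 1 / (1 + |(k : ℝ)|) ^ 2 := by
    refine Summable.of_norm_bounded_eventually
      ((Real.summable_one_div_int_pow (p := 2)).2 one_lt_two) ?_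
    filter_upwards [(Set.finite_singleton (0 : ℤ)).compl_mem_cofinite] with k hk
    have hk' : (0 : ℝ) < (k : ℝ) ^ 2 := by
      have : (k : ℝ) ≠ 0 := by simpa using hk
      positivity
    rw [Real.norm_of_nonneg (by positivity)]
    refine one_div_le_one_div_of_le hk' ?_
    nlinarith [sq_abs (k : ℝ), abs_nonneg (k : ℝ)]
  have hgeom : Summable fun j : ℕ => (64 / 81 : ℝ) ^ j :=
    summable_geometric_of_lt_one (by norm_num) (by norm_num)
  refine Summable.of_nonneg_of_le (fun i => by positivity) (fun i => ?_)
    ((hgeom.mul_of_nonneg hint (fun j => by positivity) (fun k => by positivity)).mul_left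
      ((128 * C) ^ 2))
  obtain ⟨j, k⟩ := i
  simp only
  set a := |(k : ℝ)| with ha
  have ha0 : 0 ≤ a := abs_nonneg _
  have h2 : (1 : ℝ) ≤ 2 ^ j := one_le_pow₀ (by norm_num)
  have hx : (1 + a) / 2 ^ j ≤ 1 + a / 2 ^ j := by
    rw [add_div]; gcongr; exact div_le_one_of_le₀ h2 (by positivity)
  have hx1 : 1 ≤ 1 + a / 2 ^ j := by linarith [div_nonneg ha0 (by positivity : (0 : ℝ) ≤ 2 ^ j)]
  have hx4 : ((1 + a) / 2 ^ j) ^ 2 ≤ ((1 + a / 2 ^ j) ^ 2) ^ 2 :=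
    pow_le_pow_left₀ (by positivity) (hx.trans (le_self_pow₀ hx1 two_ne_zero)) 2
  have hpow : (64 / 81 : ℝ) ^ j = 1 / (((9 / 4) ^ j) ^ 2 * (1 / 2 ^ j) ^ 2) := by
    rw [← one_div_pow, ← pow_mul, ← pow_mul, mul_comm j, pow_mul, pow_mul, ← mul_pow,
      ← one_div_pow]
    norm_num
  calc _ = (128 * C) ^ 2 * (1 / (((9 / 4) ^ j) ^ 2 * ((1 + a / 2 ^ j) ^ 2) ^ 2)) := by
        field_simp
    _ ≤ (128 * C) ^ 2 * (1 / (((9 / 4) ^ j) ^ 2 * ((1 + a) / 2 ^ j) ^ 2)) := by gcongr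
    _ = _ := by rw [hpow]; field_simp

theorem linear_growth
    {Ω : Type*} [MeasurableSpace Ω] (P : Measure Ω) [IsProbabilityMeasure P]
    (μ : Measure ℝ) [IsProbabilityMeasure μ]
    (hsymm : μ.map (fun x => -x) = μ)
    (hmom : ∀ n : ℕ, Integrable (fun l : ℝ => (abs l) ^ n) μ)
    (F : ℝ → Ω → ℝ) (hF : IsSGP P μ F) :
    ∃ c > (0:ℝ), ∃ M₀ > (0:ℝ), ∀ M ≥ M₀,
      ENNReal.ofReal (1 - Real.exp (-c * M ^ 2)) ≤
        P {ω | ∀ s : ℝ, |F s ω| ≤ M * (1 + |s|)} := by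
  have hμ : Integrable (fun l : ℝ => l ^ 2) μ := by simpa using hmom 2
  have hm : 0 ≤ ∫ l, l ^ 2 ∂μ := integral_nonneg fun l => sq_nonneg l
  set C : ℝ := 1 + ∫ l, l ^ 2 ∂μ with hCdef
  have hC : 0 < C := by positivity
  obtain ⟨c, hc, M₀, hM₀, hbound⟩ := exists_measure_exists_lt_abs_le
    (w := dyadicWeight) (δ := 1 / (128 * C))
    (y := fun i => (9 / 4 : ℝ) ^ i.1 * (1 + |(i.2 : ℝ)| / 2 ^ i.1) ^ 2 / (128 * C))
    (hF.hasSubgaussianMGF_dyadicIncrement hμ) dyadicWeight_nonneg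
    (fun i => by
      rw [Real.coe_toNNReal _ (by positivity), ← hCdef, dyadicWeight]
      have h : (9 / 4 : ℝ) ^ i.1 = ((3 / 4) ^ i.1) ^ 2 * 4 ^ i.1 := by
        rw [← pow_mul, mul_comm i.1, pow_mul, ← mul_pow]; norm_num
      rw [h]
      field_simp
      norm_num)
    (by positivity)
    (fun i => by
      gcongr
      refine one_le_mul_of_one_le_of_one_le (one_le_pow₀ (by norm_num)) (one_le_pow₀ ?_)
      exact le_add_of_nonneg_right (by positivity))
    (summable_dyadic hC)
  refine ⟨c, hc, M₀, hM₀, fun M hM => ?_⟩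
  have hcover : (univ : Set Ω) ⊆ {ω | ∀ s : ℝ, |F s ω| ≤ M * (1 + |s|)} ∪
      {ω | ∃ i, M * dyadicWeight i < |dyadicIncrement (fun t => F t ω) i|} := by
    intro ω _
    by_cases h : ∃ i, M * dyadicWeight i < |dyadicIncrement (fun t => F t ω) i|
    · exact Or.inr h
    · push Not at h
      exact Or.inl fun s => abs_le_of_dyadicIncrement_le (hF.1 ω) (hM₀.le.trans hM) h s
  rw [ENNReal.ofReal_sub _ (Real.exp_pos _).le, ENNReal.ofReal_one, tsub_le_iff_right]
  calc 1 = P univ := measure_univ.symm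
    _ ≤ _ := (measure_mono hcover).trans (measure_union_le _ _)
    _ ≤ _ := by gcongr; exact hbound M hM
end

section
/- Let μ be a symmetric Borel probability measure on ℝ all of whose moments are finite and whose absolutely continuous part (with respect to Lebesgue measure) is nonzero, and let F be a continuous centered stationary Gaussian process with spectral measure μ. Then there exist α, β > 0 such that for all T ≥ 1 and all ℓ > 0, P( sup_{t ∈ [0,T]} |F_t| ≤ ℓ ) ≤ exp(β·T²) · ℓ^{α·T}. -/
open MeasureTheory ProbabilityTheory Set ENNReal NNReal

open Polynomial in
/-- A Remez-type inequality on the unit circle, deduced from the Mahler measure lower bound: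
a polynomial of degree less than `N` cannot be small on a set of arguments of positive measure. -/
theorem supNorm_sq_le_setIntegral_norm_sq_eval_circleMap
    (a : ℝ) (E : Set ℝ) (hE : MeasurableSet E)
    (hEI : E ⊆ Ioc a (a + 2 * Real.pi))
    (hE0 : volume E ≠ 0) (N : ℕ) (p : ℂ[X]) (hp : p.natDegree < N) :
    Real.exp (-(8 * Real.pi / volume.real E) * N) * (N * p.supNorm) ^ 2 ≤
      ∫ θ in E, ‖p.eval (circleMap 0 1 θ)‖ ^ 2 := by
  by_cases hp0 : p = 0
  · simp [hp0]
  have hpi := Real.pi_pos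
  have hN : (1 : ℝ) ≤ N := by exact_mod_cast (by omega : 1 ≤ N)
  have hS : 0 < p.supNorm := by
    refine lt_of_le_of_ne p.supNorm_nonneg fun h => hp0 ?_
    exact p.supNorm_eq_zero_iff.mp h.symm
  have hEtop : volume E ≠ ⊤ := ((measure_mono hEI).trans_lt measure_Ioc_lt_top).ne
  have hEpos : 0 < volume.real E := ENNReal.toReal_pos hE0 hEtop
  set V := volume.real E with hV
  set f : ℝ → ℝ := fun θ => ‖p.eval (circleMap 0 1 θ)‖ with hf
  have hfc : Continuous f := by
    have := p.continuous
    have := continuous_circleMap 0 1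
    fun_prop
  have hflog : ∀ a b, IntervalIntegrable (fun θ => Real.log (f θ)) volume a b := by
    intro a b
    refine Function.Periodic.intervalIntegrable₀ (T := 2 * Real.pi) ?_ (by positivity)
      (p.intervalIntegrable_mahlerMeasure) a b
    intro θ
    simp only [periodic_circleMap 0 1 θ]
  have hmahler : (∫ θ in a..(a + 2 * Real.pi), Real.log (f θ)) =
      2 * Real.pi * Real.log p.mahlerMeasure := by
    have hper : Function.Periodic (fun θ => Real.log (f θ)) (2 * Real.pi) := by
      intro θ
      simp only [hf, periodic_circleMap 0 1 θ]
    rw [hper.intervalIntegral_add_eq a 0, zero_add, mahlerMeasure_def_of_ne_zero hp0, Real.log_exp]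
    field_simp
    rfl
  have hM : Real.log p.supNorm - N * Real.log 2 ≤ Real.log p.mahlerMeasure := by
    have h1 := p.supNorm_le_choose_natDegree_div_two_mul_mahlerMeasure
    have hm := mahlerMeasure_pos_of_ne_zero hp0
    have h2 : p.supNorm ≤ 2 ^ N * p.mahlerMeasure := by
      refine h1.trans (mul_le_mul_of_nonneg_right ?_ hm.le)
      have : p.natDegree.choose (p.natDegree / 2) ≤ 2 ^ N :=
        (Nat.choose_le_two_pow _ _).trans (Nat.pow_le_pow_right (by norm_num) hp.le)
      exact_mod_cast this
    have h3 := Real.log_le_log hS h2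
    rw [Real.log_mul (by positivity) hm.ne', Real.log_pow] at h3
    linarith
  have hfle : ∀ θ, f θ ≤ N * p.supNorm := by
    intro θ
    simp only [hf]
    rw [eval_eq_sum_range' hp]
    refine (norm_sum_le _ _).trans ?_
    have : ∀ i ∈ Finset.range N, ‖p.coeff i * circleMap 0 1 θ ^ i‖ ≤ p.supNorm := by
      intro i _
      rw [norm_mul, norm_pow, norm_circleMap_zero]
      simpa using p.le_supNorm i
    simpa using Finset.sum_le_sum this
  have hne : ∀ᵐ θ ∂volume, f θ ≠ 0 := by
    have hc : (circleMap 0 1 ⁻¹' (p.rootSet ℂ)).Countable :=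
      Set.Countable.preimage_circleMap (p.rootSet_finite ℂ).countable 0 one_ne_zero
    filter_upwards [hc.ae_notMem volume] with θ hθ h0
    apply hθ
    simp only [hf, norm_eq_zero] at h0
    simp [mem_rootSet, hp0, h0]
  set u := Real.log (N * p.supNorm) with hu
  set K := 4 * Real.pi * N / V with hK
  set s := Real.exp (-2 * K) * (N * p.supNorm) ^ 2 with hs
  have hspos : 0 < s := by positivity
  have hlogs : Real.log s = -2 * K + 2 * u := by
    rw [hs, Real.log_mul (by positivity) (by positivity), Real.log_exp, Real.log_pow]
    push_cast; ring
  have hpt : ∀ᵐ θ ∂volume, Real.log (f θ) ≤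
      u + E.indicator (fun θ => f θ ^ 2 / (2 * s) - K) θ := by
    filter_upwards [hne] with θ hθ
    have hf0 : 0 < f θ := lt_of_le_of_ne (norm_nonneg _) hθ.symm
    by_cases hθE : θ ∈ E
    · rw [indicator_of_mem hθE]
      have h1 := Real.log_le_sub_one_of_pos (show 0 < f θ ^ 2 / s by positivity)
      rw [Real.log_div (by positivity) hspos.ne', hlogs, Real.log_pow] at h1
      have : f θ ^ 2 / (2 * s) = (f θ ^ 2 / s) / 2 := by field_simp
      push_cast at h1
      linarith
    · rw [indicator_of_notMem hθE, add_zero]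
      exact Real.log_le_log hf0 (hfle θ)
  have hfi : IntegrableOn (fun θ => f θ ^ 2) E :=
    ((hfc.pow 2).integrableOn_Ioc (a := a) (b := a + 2 * Real.pi)).mono_set hEI
  have hi1 : IntegrableOn (fun θ => f θ ^ 2 / (2 * s) - K) E :=
    (hfi.div_const _).sub (integrableOn_const hEtop)
  have hab : a ≤ a + 2 * Real.pi := by linarith
  have hi2 : Integrable (E.indicator (fun θ => f θ ^ 2 / (2 * s) - K)) :=
    (integrable_indicator_iff hE).2 hi1
  have hint := intervalIntegral.integral_mono_ae (μ := volume) hab (hflog a (a + 2 * Real.pi))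
    ((intervalIntegrable_const (c := u)).add hi2.intervalIntegrable) hpt
  rw [hmahler, intervalIntegral.integral_add intervalIntegrable_const hi2.intervalIntegrable,
    intervalIntegral.integral_of_le hab (f := E.indicator _), setIntegral_indicator hE,
    inter_eq_self_of_subset_right hEI, integral_sub (hfi.div_const _) (integrableOn_const hEtop),
    integral_div] at hint
  simp only [intervalIntegral.integral_const, add_sub_cancel_left, smul_eq_mul,
    setIntegral_const] at hint
  rw [← hV] at hint
  have hKV : V * K = 4 * Real.pi * N := by rw [hK]; field_simp
  have hu' : u = Real.log N + Real.log p.supNorm := Real.log_mul (by positivity) hS.ne'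
  have hlogN : Real.log N ≤ N - 1 := Real.log_le_sub_one_of_pos (by linarith)
  have hl2 : Real.log 2 ≤ 1 := by linarith [Real.log_le_sub_one_of_pos (two_pos : (0:ℝ) < 2)]
  have h5 : 2 * Real.pi * (Real.log p.supNorm - N * 1) ≤ 2 * Real.pi * Real.log p.mahlerMeasure := by
    gcongr
    refine le_trans ?_ hM
    gcongr
  have h6 : 2 * Real.pi * u ≤ 2 * Real.pi * (N - 1 + Real.log p.supNorm) := by
    gcongr; linarith
  have h7 : 1 / 2 ≤ (∫ θ in E, f θ ^ 2) / (2 * s) := by nlinarith [Real.pi_gt_three]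
  rw [le_div_iff₀ (by positivity)] at h7
  have h8 : -(8 * Real.pi / V) * N = -2 * K := by rw [hK]; ring
  rw [h8]
  linarith

/-- A measure with nonzero absolutely continuous part dominates a multiple of Lebesgue measure on
a set of positive measure contained in an interval of length `2π`. -/
theorem exists_smul_volume_restrict_le (μ : Measure ℝ)
    (hac : MeasureTheory.volume.withDensity (μ.rnDeriv MeasureTheory.volume) ≠ 0) :
    ∃ ε > (0 : ℝ), ∃ a : ℝ, ∃ E : Set ℝ, MeasurableSet E ∧ E ⊆ Ioc a (a + 2 * Real.pi) ∧
      volume E ≠ 0 ∧ ENNReal.ofReal ε • volume.restrict E ≤ μ := by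
  set g := μ.rnDeriv volume with hg
  have hgm : Measurable g := Measure.measurable_rnDeriv _ _
  have h1 : volume {x | g x ≠ 0} ≠ 0 := by
    intro h
    apply hac
    rw [withDensity_eq_zero_iff hgm.aemeasurable]
    exact h
  have h2 : {x | g x ≠ 0} ⊆ ⋃ n : ℕ, ⋃ k : ℤ, {x | ENNReal.ofReal (1 / ((n : ℝ) + 1)) ≤ g x} ∩
      Ioc (0 + k • (2 * Real.pi)) (0 + (k + 1) • (2 * Real.pi)) := by
    intro x hx
    obtain ⟨r, hr⟩ : ∃ n : ℕ, ENNReal.ofReal (1 / ((n : ℝ) + 1)) ≤ g x := by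
      rcases eq_or_ne (g x) ⊤ with h | h
      · exact ⟨0, by simp [h]⟩
      · obtain ⟨n, hn⟩ := exists_nat_one_div_lt (ENNReal.toReal_pos hx h)
        exact ⟨n, (ENNReal.ofReal_le_iff_le_toReal h).2 hn.le⟩
    have h3 := iUnion_Ioc_add_zsmul (α := ℝ) (p := 2 * Real.pi) (by positivity) 0
    have h4 : x ∈ ⋃ n : ℤ, Ioc (0 + n • (2 * Real.pi)) (0 + (n + 1) • (2 * Real.pi)) := by
      rw [h3]; trivial
    obtain ⟨k, hk⟩ := mem_iUnion.1 h4
    exact mem_iUnion.2 ⟨r, mem_iUnion.2 ⟨k, hr, hk⟩⟩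
  obtain ⟨n, k, hnk⟩ : ∃ n : ℕ, ∃ k : ℤ,
      volume ({x | ENNReal.ofReal (1 / ((n : ℝ) + 1)) ≤ g x} ∩
      Ioc (0 + k • (2 * Real.pi)) (0 + (k + 1) • (2 * Real.pi))) ≠ 0 := by
    by_contra! hcon
    refine h1 (measure_mono_null h2 ?_)
    simp only [measure_iUnion_null_iff]
    exact hcon
  have hEm : MeasurableSet ({x | ENNReal.ofReal (1 / ((n : ℝ) + 1)) ≤ g x} ∩
      Ioc (0 + k • (2 * Real.pi)) (0 + (k + 1) • (2 * Real.pi))) :=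
    (measurableSet_le measurable_const hgm).inter measurableSet_Ioc
  refine ⟨1 / ((n : ℝ) + 1), by positivity, 0 + k • (2 * Real.pi), _, hEm, ?_, hnk, ?_⟩
  · refine inter_subset_right.trans (Ioc_subset_Ioc_right (le_of_eq ?_))
    simp; ring
  · refine le_trans ?_ (Measure.withDensity_rnDeriv_le μ volume)
    rw [← withDensity_const, ← withDensity_indicator hEm]
    refine withDensity_mono (Filter.Eventually.of_forall fun x => ?_)
    refine indicator_le (fun x hx => hx.1) x

open Polynomial in
theorem norm_sq_eval_circleMap (N : ℕ) (c : Fin N → ℝ) (θ : ℝ) :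
    ‖(∑ i, C (c i : ℂ) * X ^ (i : ℕ) : ℂ[X]).eval (circleMap 0 1 θ)‖ ^ 2 =
      ∑ i, ∑ j, c i * c j * Real.cos (θ * (((i : ℕ) : ℝ) - ((j : ℕ) : ℝ))) := by
  have h : (∑ i, C (c i : ℂ) * X ^ (i : ℕ) : ℂ[X]).eval (circleMap 0 1 θ) =
      ((∑ i, c i * Real.cos (θ * (i : ℕ)) : ℝ) : ℂ) +
        ((∑ i, c i * Real.sin (θ * (i : ℕ)) : ℝ) : ℂ) * Complex.I := by
    simp only [eval_finsetSum, eval_mul, eval_C, eval_pow, eval_X, circleMap_zero,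
      Complex.ofReal_one, one_mul, ← Complex.exp_nat_mul]
    push_cast
    rw [Finset.sum_mul, ← Finset.sum_add_distrib]
    refine Finset.sum_congr rfl fun i _ => ?_
    rw [show ((i : ℕ) : ℂ) * (θ * Complex.I) = (θ * (i : ℕ)) * Complex.I by ring,
      Complex.exp_mul_I]
    ring
  rw [h, ← Complex.normSq_eq_norm_sq, Complex.normSq_add_mul_I, sq, sq, Finset.sum_mul_sum,
    Finset.sum_mul_sum, ← Finset.sum_add_distrib]
  refine Finset.sum_congr rfl fun i _ => ?_
  rw [← Finset.sum_add_distrib]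
  refine Finset.sum_congr rfl fun j _ => ?_
  rw [mul_sub, Real.cos_sub]
  ring

theorem integrable_cos_mul (μ : Measure ℝ) [IsProbabilityMeasure μ] (t : ℝ) :
    Integrable (fun l => Real.cos (l * t)) μ :=
  Integrable.of_bound (by fun_prop) 1 (Filter.Eventually.of_forall fun l => Real.abs_cos_le_one _)

open Polynomial in
/-- The least eigenvalue of the covariance matrix at the points `0, …, N - 1` decays at most
exponentially in `N`. -/
theorem covKernel_lower_bound (μ : Measure ℝ) [IsProbabilityMeasure μ]
    (hac : MeasureTheory.volume.withDensity (μ.rnDeriv MeasureTheory.volume) ≠ 0) :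
    ∃ K > (0 : ℝ), ∀ (N : ℕ) (c : Fin N → ℝ), Real.exp (-K * N) * ∑ i, c i ^ 2 ≤
      ∑ i, ∑ j, c i * c j * covKernel μ (((i : ℕ) : ℝ) - ((j : ℕ) : ℝ)) := by
  obtain ⟨ε, hε, a, E, hE, hEI, hE0, hle⟩ := exists_smul_volume_restrict_le μ hac
  have hpi := Real.pi_pos
  refine ⟨8 * Real.pi / volume.real E + |Real.log ε| + 1, by positivity, fun N c => ?_⟩
  rcases Nat.eq_zero_or_pos N with rfl | hN
  · simp
  set p : ℂ[X] := ∑ i, C (c i : ℂ) * X ^ (i : ℕ) with hp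
  have hdeg : p.natDegree < N := by
    refine Nat.lt_of_le_pred hN (natDegree_sum_le_of_forall_le _ _ fun i _ => ?_)
    exact (natDegree_C_mul_X_pow_le _ _).trans (Nat.le_pred_of_lt i.2)
  have hcoeff : ∀ i : Fin N, p.coeff i = c i := by
    intro i
    simp [hp, coeff_C_mul, coeff_X_pow, Fin.val_inj]
  have hsum : ∑ i, c i ^ 2 ≤ (N * p.supNorm) ^ 2 := by
    have h1 : ∀ i ∈ Finset.univ, c i ^ 2 ≤ p.supNorm ^ 2 := by
      intro i _
      rw [← sq_abs]
      gcongr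
      have := p.le_supNorm i
      rwa [hcoeff, Complex.norm_real] at this
    have h2 := Finset.sum_le_sum h1
    simp only [Finset.sum_const, Finset.card_univ, Fintype.card_fin, nsmul_eq_mul] at h2
    refine h2.trans ?_
    rw [mul_pow]
    have hN1 : (1 : ℝ) ≤ N := by exact_mod_cast hN
    gcongr
    nlinarith
  have hrem := supNorm_sq_le_setIntegral_norm_sq_eval_circleMap a E hE hEI hE0 N p hdeg
  have hint : ∑ i, ∑ j, c i * c j * covKernel μ (((i : ℕ) : ℝ) - ((j : ℕ) : ℝ)) =
      ∫ θ, ‖p.eval (circleMap 0 1 θ)‖ ^ 2 ∂μ := by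
    simp only [hp, norm_sq_eval_circleMap, covKernel]
    have hi := integrable_cos_mul μ
    rw [integral_finsetSum _ fun i _ => integrable_finsetSum _ fun j _ => (hi _).const_mul _]
    refine Finset.sum_congr rfl fun i _ => ?_
    rw [integral_finsetSum _ fun j _ => (hi _).const_mul _]
    refine Finset.sum_congr rfl fun j _ => ?_
    rw [integral_const_mul]
  have hintμ : Integrable (fun θ => ‖p.eval (circleMap 0 1 θ)‖ ^ 2) μ := by
    simp only [hp, norm_sq_eval_circleMap]
    exact integrable_finsetSum _ fun i _ => integrable_finsetSum _ fun j _ =>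
      (integrable_cos_mul μ _).const_mul _
  have hmono := integral_mono_measure hle
    (Filter.Eventually.of_forall fun θ => by positivity) hintμ
  rw [integral_smul_measure, ENNReal.toReal_ofReal hε.le, smul_eq_mul] at hmono
  rw [hint]
  refine le_trans ?_ hmono
  have hexp : Real.exp (-(8 * Real.pi / volume.real E + |Real.log ε| + 1) * N) ≤
      ε * Real.exp (-(8 * Real.pi / volume.real E) * N) := by
    have hN1 : (1 : ℝ) ≤ N := by exact_mod_cast hN
    nth_rw 2 [← Real.exp_log hε]
    rw [← Real.exp_add]
    gcongr
    nlinarith [neg_abs_le (Real.log ε), abs_nonneg (Real.log ε)]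
  calc _ ≤ (ε * Real.exp (-(8 * Real.pi / volume.real E) * N)) * (N * p.supNorm) ^ 2 := by
        gcongr
    _ = ε * (Real.exp (-(8 * Real.pi / volume.real E) * N) * (N * p.supNorm) ^ 2) := by ring
    _ ≤ _ := by gcongr

theorem integral_exp_neg_mul_sq_gaussianReal_le {a : ℝ} (ha : 0 < a) :
    ∫ x, Real.exp (-(a * x ^ 2 / 2)) ∂(gaussianReal 0 1) ≤ (√a)⁻¹ := by
  have hpi := Real.pi_pos
  rw [integral_gaussianReal_eq_integral_smul one_ne_zero]
  have h : ∀ x : ℝ, gaussianPDFReal 0 1 x • Real.exp (-(a * x ^ 2 / 2)) ≤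
      (√(2 * Real.pi))⁻¹ * Real.exp (-(a / 2) * x ^ 2) := by
    intro x
    rw [gaussianPDFReal_def, smul_eq_mul]
    have h1 : Real.exp (-(x - 0) ^ 2 / (2 * ((1 : ℝ≥0) : ℝ))) ≤ 1 := by
      rw [Real.exp_le_one_iff]
      have := sq_nonneg (x - 0)
      norm_num
      nlinarith
    rw [show -(a * x ^ 2 / 2) = -(a / 2) * x ^ 2 by ring]
    refine mul_le_mul_of_nonneg_right ?_ (Real.exp_nonneg _)
    simpa using mul_le_mul_of_nonneg_left h1 (by positivity : 0 ≤ (√(2 * Real.pi))⁻¹)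
  refine (integral_mono_of_nonneg (Filter.Eventually.of_forall fun x => ?_)
    ((integrable_exp_neg_mul_sq (half_pos ha)).const_mul _)
    (Filter.Eventually.of_forall h)).trans (le_of_eq ?_)
  · exact mul_nonneg (gaussianPDFReal_nonneg _ _ _) (Real.exp_nonneg _)
  · rw [integral_const_mul, integral_gaussian, ← Real.sqrt_inv, ← Real.sqrt_inv,
      ← Real.sqrt_mul (by positivity)]
    congr 1
    field_simp

theorem integral_cexp_sum_gaussianReal_pi {N : ℕ} (x : Fin N → ℝ) :
    ∫ g, Complex.exp (((∑ i, g i * x i : ℝ) : ℂ) * Complex.I)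
        ∂(Measure.pi fun _ : Fin N => gaussianReal 0 1) =
      ((Real.exp (-((∑ i, x i ^ 2) / 2)) : ℝ) : ℂ) := by
  have h : ∀ g : Fin N → ℝ, Complex.exp (((∑ i, g i * x i : ℝ) : ℂ) * Complex.I) =
      ∏ i, Complex.exp ((x i : ℂ) * (g i : ℂ) * Complex.I) := by
    intro g
    rw [← Complex.exp_sum]
    push_cast
    rw [Finset.sum_mul]
    congr 1
    exact Finset.sum_congr rfl fun i _ => by ring
  simp_rw [h]
  rw [integral_fintype_prod_eq_prod (fun i (y : ℝ) => Complex.exp ((x i : ℂ) * (y : ℂ) * Complex.I))]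
  simp_rw [← charFun_apply_real, charFun_gaussianReal, ← Complex.exp_sum]
  push_cast
  congr 1
  simp [Finset.sum_div]

/-- If every linear combination of `X` is a centered Gaussian whose variance is at least
`lam * |c|²`, then `X` lies in a cube of half-side `ℓ` with probability
at most `exp (N / 2) * (ℓ / √lam) ^ N`. -/
theorem gaussian_small_ball {Ω : Type*} [MeasurableSpace Ω] (P : Measure Ω) [IsProbabilityMeasure P]
    {N : ℕ} (X : Fin N → Ω → ℝ) (hX : ∀ i, AEMeasurable (X i) P) (v : (Fin N → ℝ) → ℝ≥0)
    (hlaw : ∀ c, P.map (fun ω => ∑ i, c i * X i ω) = gaussianReal 0 (v c))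
    {lam : ℝ} (hlam : 0 < lam) (hv : ∀ c, lam * ∑ i, c i ^ 2 ≤ v c) {ℓ : ℝ} (hℓ : 0 < ℓ) :
    P {ω | ∀ i, |X i ω| ≤ ℓ} ≤ ENNReal.ofReal (Real.exp (N / 2) * (ℓ / √lam) ^ N) := by
  set γ : Measure (Fin N → ℝ) := Measure.pi fun _ : Fin N => gaussianReal 0 1 with hγ
  have hmeasG : AEMeasurable (fun ω => Real.exp (-((∑ i, (X i ω / ℓ) ^ 2) / 2))) P := by
    fun_prop
  have hGle : ∀ ω, Real.exp (-((∑ i, (X i ω / ℓ) ^ 2) / 2)) ≤ 1 := by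
    intro ω
    rw [Real.exp_le_one_iff, neg_nonpos]
    positivity
  have hGint : Integrable (fun ω => Real.exp (-((∑ i, (X i ω / ℓ) ^ 2) / 2))) P := by
    refine Integrable.of_bound hmeasG.aestronglyMeasurable 1 (Filter.Eventually.of_forall fun ω => ?_)
    rw [Real.norm_of_nonneg (Real.exp_nonneg _)]
    exact hGle ω
  have hchar : ∀ c : Fin N → ℝ, ∫ ω, Complex.exp (((∑ i, c i * (X i ω / ℓ) : ℝ) : ℂ) * Complex.I) ∂P =
      ((Real.exp (-(v (fun i => c i / ℓ) / 2)) : ℝ) : ℂ) := by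
    intro c
    have h1 := charFun_gaussianReal (μ := 0) (v := v (fun i => c i / ℓ)) 1
    rw [← hlaw, charFun_apply_real, integral_map (by fun_prop) (by fun_prop)] at h1
    have h2 : ∀ ω, ∑ i, c i * (X i ω / ℓ) = ∑ i, c i / ℓ * X i ω := fun ω =>
      Finset.sum_congr rfl fun i _ => by ring
    simp_rw [h2]
    simp only [Complex.ofReal_one, one_mul] at h1
    rw [h1]
    push_cast
    simp
  have hswap : ∫ ω, Real.exp (-((∑ i, (X i ω / ℓ) ^ 2) / 2)) ∂P =
      ∫ c, Real.exp (-(v (fun i => c i / ℓ) / 2)) ∂γ := by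
    have h1 : Integrable (Function.uncurry fun (ω : Ω) (c : Fin N → ℝ) =>
        Complex.exp (((∑ i, c i * (X i ω / ℓ) : ℝ) : ℂ) * Complex.I)) (P.prod γ) := by
      refine Integrable.of_bound (AEMeasurable.aestronglyMeasurable ?_) 1
        (Filter.Eventually.of_forall fun z => ?_)
      · have h2 : ∀ i, AEMeasurable (fun z : Ω × (Fin N → ℝ) => X i z.1) (P.prod γ) :=
          fun i => (hX i).comp_fst
        have h3 : ∀ i, Measurable (fun z : Ω × (Fin N → ℝ) => z.2 i) := fun i => by fun_prop
        simp only [Function.uncurry_def]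
        fun_prop
      · simp only [Function.uncurry_def]
        exact (Complex.norm_exp_ofReal_mul_I _).le
    have h2 := integral_integral_swap h1
    simp_rw [hchar, hγ, integral_cexp_sum_gaussianReal_pi, integral_complex_ofReal] at h2
    exact_mod_cast h2
  have hbound : ∫ ω, Real.exp (-((∑ i, (X i ω / ℓ) ^ 2) / 2)) ∂P ≤ (ℓ / √lam) ^ N := by
    rw [hswap]
    have hle : ∀ c : Fin N → ℝ, Real.exp (-(v (fun i => c i / ℓ) / 2)) ≤
        ∏ i, Real.exp (-((lam / ℓ ^ 2) * c i ^ 2 / 2)) := by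
      intro c
      rw [← Real.exp_sum]
      gcongr
      have h1 := hv (fun i => c i / ℓ)
      simp_rw [div_pow] at h1
      rw [← Finset.sum_div] at h1
      rw [Finset.sum_neg_distrib, ← Finset.sum_div, ← Finset.mul_sum]
      have : lam / ℓ ^ 2 * ∑ i, c i ^ 2 = lam * ((∑ i, c i ^ 2) / ℓ ^ 2) := by ring
      rw [this]
      linarith
    have hint : Integrable (fun c : Fin N → ℝ => ∏ i, Real.exp (-((lam / ℓ ^ 2) * c i ^ 2 / 2))) γ := by
      refine Integrable.of_bound (Measurable.aestronglyMeasurable (by fun_prop)) 1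
        (Filter.Eventually.of_forall fun c => ?_)
      rw [← Real.exp_sum, Real.norm_of_nonneg (Real.exp_nonneg _), Real.exp_le_one_iff,
        Finset.sum_neg_distrib, neg_nonpos]
      positivity
    refine (integral_mono_of_nonneg (Filter.Eventually.of_forall fun c => Real.exp_nonneg _) hint
      (Filter.Eventually.of_forall hle)).trans ?_
    rw [hγ, integral_fintype_prod_eq_prod (fun (_ : Fin N) (y : ℝ) =>
      Real.exp (-((lam / ℓ ^ 2) * y ^ 2 / 2))), Finset.prod_const, Finset.card_univ,
      Fintype.card_fin]
    have h1 := integral_exp_neg_mul_sq_gaussianReal_le (show 0 < lam / ℓ ^ 2 by positivity)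
    rw [Real.sqrt_div' _ (by positivity), Real.sqrt_sq hℓ.le, inv_div] at h1
    exact pow_le_pow_left₀ (integral_nonneg fun _ => Real.exp_nonneg _) h1 N
  have hmarkov : P.real {ω | ∀ i, |X i ω| ≤ ℓ} ≤ Real.exp (N / 2) * (ℓ / √lam) ^ N := by
    have hsub : {ω | ∀ i, |X i ω| ≤ ℓ} ⊆
        {ω | Real.exp (-(N / 2)) ≤ Real.exp (-((∑ i, (X i ω / ℓ) ^ 2) / 2))} := by
      intro ω hω
      simp only [mem_ofPred_eq, Real.exp_le_exp, neg_le_neg_iff]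
      gcongr
      have h1 : ∀ i ∈ Finset.univ, (X i ω / ℓ) ^ 2 ≤ 1 := by
        intro i _
        rw [sq_le_one_iff_abs_le_one, abs_div, abs_of_pos hℓ, div_le_one hℓ]
        exact hω i
      simpa using Finset.sum_le_sum h1
    have h1 := mul_meas_ge_le_integral_of_nonneg
      (Filter.Eventually.of_forall fun ω => Real.exp_nonneg _) hGint (Real.exp (-(N / 2)))
    have h2 := measureReal_mono (μ := P) hsub
    have h3 : Real.exp (-(N / 2 : ℝ)) * P.real {ω | ∀ i, |X i ω| ≤ ℓ} ≤ (ℓ / √lam) ^ N :=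
      (mul_le_mul_of_nonneg_left h2 (Real.exp_nonneg _)).trans (h1.trans hbound)
    rw [Real.exp_neg, inv_mul_le_iff₀ (Real.exp_pos _)] at h3
    exact h3
  rw [← ofReal_measureReal]
  exact ENNReal.ofReal_le_ofReal hmarkov

theorem IsSGP.aemeasurable {Ω : Type*} [MeasurableSpace Ω] {P : Measure Ω} {μ : Measure ℝ}
    {F : ℝ → Ω → ℝ} (hF : IsSGP P μ F) (t : ℝ) : AEMeasurable (F t) P := by
  have h := hF.2 1 (fun _ => t) (fun _ => 1)
  simp only [Finset.univ_unique, Finset.sum_singleton, one_mul] at h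
  by_contra hcon
  rw [Measure.map_of_not_aemeasurable hcon] at h
  exact IsProbabilityMeasure.ne_zero _ h.symm

theorem small_ball_upper
    {Ω : Type*} [MeasurableSpace Ω] (P : Measure Ω) [IsProbabilityMeasure P]
    (μ : Measure ℝ) [IsProbabilityMeasure μ]
    (hsymm : μ.map (fun x => -x) = μ)
    (hmom : ∀ n : ℕ, Integrable (fun l : ℝ => (abs l) ^ n) μ)
    (hac : MeasureTheory.volume.withDensity (μ.rnDeriv MeasureTheory.volume) ≠ 0)
    (F : ℝ → Ω → ℝ) (hF : IsSGP P μ F) :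
    ∃ α > (0:ℝ), ∃ β > (0:ℝ), ∀ T ≥ (1:ℝ), ∀ ℓ > (0:ℝ),
      P {ω | ∀ t ∈ Set.Icc (0:ℝ) T, |F t ω| ≤ ℓ} ≤
        ENNReal.ofReal (Real.exp (β * T ^ 2) * ℓ ^ (α * T)) := by
  obtain ⟨K, hK, hcov⟩ := covKernel_lower_bound μ hac
  refine ⟨1, one_pos, 2 * K + 1, by positivity, fun T hT ℓ hℓ => ?_⟩
  rw [one_mul]
  have hT0 : 0 ≤ T := zero_le_one.trans hT
  rcases le_or_gt 1 ℓ with hℓ1 | hℓ1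
  · refine prob_le_one.trans ?_
    rw [ENNReal.one_le_ofReal]
    exact one_le_mul_of_one_le_of_one_le (Real.one_le_exp (by positivity))
      (Real.one_le_rpow hℓ1 hT0)
  set N : ℕ := ⌊T⌋₊ + 1 with hN
  have hNT : T ≤ N := by simpa [hN] using (Nat.lt_floor_add_one T).le
  have hN2 : (N : ℝ) ≤ 2 * T := by
    have := Nat.floor_le hT0
    rw [hN]; push_cast; linarith
  have hsub : {ω | ∀ t ∈ Set.Icc (0:ℝ) T, |F t ω| ≤ ℓ} ⊆
      {ω | ∀ i : Fin N, |F ((i : ℕ) : ℝ) ω| ≤ ℓ} := by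
    intro ω hω i
    refine hω _ ⟨Nat.cast_nonneg _, ?_⟩
    exact (Nat.cast_le.2 (Nat.lt_succ_iff.1 i.2)).trans (Nat.floor_le hT0)
  have hball := gaussian_small_ball P (fun (i : Fin N) ω => F ((i : ℕ) : ℝ) ω)
    (fun i => hF.aemeasurable _) _ (fun c => hF.2 N (fun i => ((i : ℕ) : ℝ)) c)
    (Real.exp_pos (-K * N)) (fun c => (hcov N c).trans (Real.le_coe_toNNReal _)) hℓ
  refine (measure_mono hsub).trans (hball.trans (ENNReal.ofReal_le_ofReal ?_))
  have hsqrt : ℓ / √(Real.exp (-K * N)) = Real.exp (K * N / 2) * ℓ := by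
    rw [← Real.exp_half, div_eq_mul_inv, ← Real.exp_neg, mul_comm]
    congr 2
    ring
  rw [hsqrt, mul_pow, ← mul_assoc, ← Real.exp_nat_mul, ← Real.exp_add]
  have hpow : ℓ ^ N ≤ ℓ ^ T := by
    rw [← Real.rpow_natCast]
    exact Real.rpow_le_rpow_of_exponent_ge hℓ hℓ1.le hNT
  gcongr
  have h1 : (N : ℝ) ^ 2 ≤ (2 * T) ^ 2 := by gcongr
  nlinarith [mul_le_mul_of_nonneg_left h1 hK.le]
end
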